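/- arXiv:0902.0967 — 2 statements merged into one kernel-verified Lean document; each statement's English description precedes it below -/
import Mathlib

section
/- Let σ ⊆ N_ℝ be a strongly convex rational polyhedral cone, Q ⊆ σ a rational polyhedron, and Q = Q_0 + Q_1 + ⋯ + Q_k a Minkowski sum decomposition into rational polyhedra. Then: (1) σ̃ ∩ (N_ℝ ⊕ {0}) = σ (identifying N_ℝ with the subspace N_ℝ ⊕ {0} of Ñ_ℝ); and (2) if 0 ∉ Q, then σ̃ is strongly convex, i.e. σ̃ ∩ (−σ̃) = {0}. -/
open Pointwise

noncomputable section

/-- The standard pairing on `ℝ^d`. -/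
def pr {d : ℕ} (u n : Fin d → ℝ) : ℝ := ∑ j, u j * n j

/-- The convex cone generated by a set: all finite nonnegative linear combinations. -/
def coneGen {E : Type*} [AddCommMonoid E] [Module ℝ E] (S : Set E) : Set E :=
  {x | ∃ (m : ℕ) (c : Fin m → ℝ) (v : Fin m → E),
    (∀ i, 0 ≤ c i) ∧ (∀ i, v i ∈ S) ∧ x = ∑ i, c i • v i}

/-- The dual cone of a subset of `ℝ^d`. -/
def dualCone {d : ℕ} (C : Set (Fin d → ℝ)) : Set (Fin d → ℝ) :=
  {u | ∀ n ∈ C, 0 ≤ pr u n}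

/-- A point of `ℝ^d` is a lattice point if all coordinates are integers. -/
def IsLattice {d : ℕ} (x : Fin d → ℝ) : Prop := ∀ j, ∃ z : ℤ, x j = (z : ℝ)

/-- The canonical map `ℤ^d → ℝ^d`. -/
def castd {d : ℕ} (z : Fin d → ℤ) : Fin d → ℝ := fun j => (z j : ℝ)

/-- A rational polyhedral cone: generated by finitely many rational vectors. -/
def IsRatPolyCone {d : ℕ} (σ : Set (Fin d → ℝ)) : Prop :=
  ∃ (m : ℕ) (v : Fin m → Fin d → ℚ), σ = coneGen (Set.range fun i => fun j => ((v i j : ℝ)))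

/-- Strong convexity of a cone: `σ ∩ (−σ) ⊆ {0}`. -/
def IsStronglyConvex {d : ℕ} (σ : Set (Fin d → ℝ)) : Prop := σ ∩ (-σ) ⊆ {0}

/-- A rational polyhedron: a finite intersection of rational half-spaces. -/
def IsRatPolyhedron {d : ℕ} (P : Set (Fin d → ℝ)) : Prop :=
  ∃ (m : ℕ) (A : Fin m → Fin d → ℚ) (b : Fin m → ℚ),
    P = {x | ∀ i, (b i : ℝ) ≤ ∑ j, (A i j : ℝ) * x j}

/-- The recession cone of a polyhedron. -/
def recCone {d : ℕ} (P : Set (Fin d → ℝ)) : Set (Fin d → ℝ) :=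
  {n | ∀ q ∈ P, ∀ t : ℝ, 0 ≤ t → q + t • n ∈ P}

/-- Condition (*): in any induced vertex decomposition all but at most one summand
is a lattice point. -/
def CondStar {d k : ℕ} (Q : Set (Fin d → ℝ)) (Qs : Fin (k + 1) → Set (Fin d → ℝ)) : Prop :=
  ∀ q ∈ Q.extremePoints ℝ, ∀ qs : Fin (k + 1) → Fin d → ℝ,
    (∀ i, qs i ∈ (Qs i).extremePoints ℝ) → q = ∑ i, qs i →
      ∃ i₀, ∀ i, i ≠ i₀ → IsLattice (qs i)

/-- The pairing on `ℝ^d × ℝ^k`. -/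
def prP {d k : ℕ} (u n : (Fin d → ℝ) × (Fin k → ℝ)) : ℝ := pr u.1 n.1 + pr u.2 n.2

/-- The dual cone of a subset of `ℝ^d × ℝ^k`. -/
def dualConeP {d k : ℕ} (C : Set ((Fin d → ℝ) × (Fin k → ℝ))) :
    Set ((Fin d → ℝ) × (Fin k → ℝ)) :=
  {u | ∀ n ∈ C, 0 ≤ prP u n}

/-- The generating set `σ ∪ (Q₀ − e₁ − ⋯ − e_k) ∪ (Q₁ + e₁) ∪ ⋯ ∪ (Q_k + e_k)` of `σ̃`. -/
def tildeGen {d k : ℕ} (σ : Set (Fin d → ℝ)) (Qs : Fin (k + 1) → Set (Fin d → ℝ)) :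
    Set ((Fin d → ℝ) × (Fin k → ℝ)) :=
  ((fun n => (n, (0 : Fin k → ℝ))) '' σ) ∪
    ((fun q => (q, fun _ => (-1 : ℝ))) '' Qs 0) ∪
    ⋃ i : Fin k, (fun q => (q, (Pi.single i 1 : Fin k → ℝ))) '' Qs i.succ

/-- The cone `σ̃ ⊆ Ñ_ℝ`. -/
def tildeCone {d k : ℕ} (σ : Set (Fin d → ℝ)) (Qs : Fin (k + 1) → Set (Fin d → ℝ)) :
    Set ((Fin d → ℝ) × (Fin k → ℝ)) :=
  coneGen (tildeGen σ Qs)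

/-- The canonical map `ℤ^d × ℤ^k → ℝ^d × ℝ^k`. -/
def castP {d k : ℕ} (z : (Fin d → ℤ) × (Fin k → ℤ)) : (Fin d → ℝ) × (Fin k → ℝ) :=
  (castd z.1, castd z.2)

theorem coneGen_add {E : Type*} [AddCommMonoid E] [Module ℝ E] {S : Set E} {x y : E}
    (hx : x ∈ coneGen S) (hy : y ∈ coneGen S) : x + y ∈ coneGen S := by
  obtain ⟨m, c, v, hc, hv, rfl⟩ := hx
  obtain ⟨m', c', v', hc', hv', rfl⟩ := hy
  refine ⟨m + m', Fin.append c c', Fin.append v v', ?_, ?_, ?_⟩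
  · intro i
    refine Fin.addCases (fun i => ?_) (fun i => ?_) i
    · simpa using hc i
    · simpa using hc' i
  · intro i
    refine Fin.addCases (fun i => ?_) (fun i => ?_) i
    · simpa using hv i
    · simpa using hv' i
  · simp [Fin.sum_univ_add]

theorem coneGen_smul {E : Type*} [AddCommMonoid E] [Module ℝ E] {S : Set E} {x : E} {t : ℝ}
    (ht : 0 ≤ t) (hx : x ∈ coneGen S) : t • x ∈ coneGen S := by
  obtain ⟨m, c, v, hc, hv, rfl⟩ := hx
  exact ⟨m, fun i => t * c i, v, fun i => mul_nonneg ht (hc i), hv, by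
    simp [Finset.smul_sum, mul_smul]⟩

theorem coneGen_zero {E : Type*} [AddCommMonoid E] [Module ℝ E] (S : Set E) :
    (0 : E) ∈ coneGen S :=
  ⟨0, Fin.elim0, Fin.elim0, fun i => i.elim0, fun i => i.elim0, by simp⟩

/-- `w` lies in the dilate `l • P`, with the convention that the dilate by zero is zero. -/
def InDil {E : Type*} [AddCommGroup E] [Module ℝ E] (P : Set E) (l : ℝ) (w : E) : Prop :=
  0 ≤ l ∧ (l = 0 → w = 0) ∧ (0 < l → ∃ q ∈ P, w = l • q)

theorem InDil.zero {E : Type*} [AddCommGroup E] [Module ℝ E] (P : Set E) :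
    InDil P 0 (0 : E) := ⟨le_rfl, fun _ => rfl, fun h => absurd h (lt_irrefl _)⟩

theorem InDil.smul {E : Type*} [AddCommGroup E] [Module ℝ E] {P : Set E} {l : ℝ} {w : E}
    (h : InDil P l w) {t : ℝ} (ht : 0 ≤ t) : InDil P (t * l) (t • w) := by
  obtain ⟨h0, h1, h2⟩ := h
  refine ⟨mul_nonneg ht h0, fun h => ?_, fun h => ?_⟩
  · rcases mul_eq_zero.1 h with h | h
    · simp [h]
    · simp [h1 h]
  · have hl : 0 < l := lt_of_le_of_ne h0 (by rintro rfl; simp at h)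
    obtain ⟨q, hq, rfl⟩ := h2 hl
    exact ⟨q, hq, by rw [mul_smul]⟩

theorem InDil.add {E : Type*} [AddCommGroup E] [Module ℝ E] {P : Set E} (hP : Convex ℝ P)
    {l l' : ℝ} {w w' : E} (h : InDil P l w) (h' : InDil P l' w') :
    InDil P (l + l') (w + w') := by
  rcases h.1.eq_or_lt with hl | hl
  · subst hl
    simpa [h.2.1 rfl] using h'
  rcases h'.1.eq_or_lt with hl' | hl'
  · subst hl'
    simpa [h'.2.1 rfl] using h
  obtain ⟨q, hq, rfl⟩ := h.2.2 hl
  obtain ⟨q', hq', rfl⟩ := h'.2.2 hl'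
  have hs : 0 < l + l' := add_pos hl hl'
  refine ⟨hs.le, fun h => absurd h hs.ne', fun _ => ?_⟩
  refine ⟨(l / (l + l')) • q + (l' / (l + l')) • q',
    hP hq hq' (by positivity) (by positivity) (by field_simp), ?_⟩
  rw [smul_add, smul_smul, smul_smul, mul_div_cancel₀ _ hs.ne', mul_div_cancel₀ _ hs.ne']

theorem IsRatPolyhedron.convex' {d : ℕ} {P : Set (Fin d → ℝ)} (h : IsRatPolyhedron P) :
    Convex ℝ P := by
  obtain ⟨m, A, b, rfl⟩ := h
  intro x hx y hy s t hs ht hst i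
  have h1 := mul_le_mul_of_nonneg_left (hx i) hs
  have h2 := mul_le_mul_of_nonneg_left (hy i) ht
  have h3 : ∑ j, (A i j : ℝ) * (s • x + t • y) j =
      s * ∑ j, (A i j : ℝ) * x j + t * ∑ j, (A i j : ℝ) * y j := by
    rw [Finset.mul_sum, Finset.mul_sum, ← Finset.sum_add_distrib]
    refine Finset.sum_congr rfl fun j _ => ?_
    simp only [Pi.add_apply, Pi.smul_apply, smul_eq_mul]
    ring
  rw [h3]
  have h4 : (b i : ℝ) = s * b i + t * b i := by rw [← add_mul, hst, one_mul]
  linarith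

/-- Normal form of elements of the cone `σ̃`. -/
def NF {d k : ℕ} (σ : Set (Fin d → ℝ)) (Qs : Fin (k + 1) → Set (Fin d → ℝ))
    (x : (Fin d → ℝ) × (Fin k → ℝ)) : Prop :=
  ∃ s ∈ σ, ∃ (l : Fin (k + 1) → ℝ) (w : Fin (k + 1) → Fin d → ℝ),
    (∀ i, InDil (Qs i) (l i) (w i)) ∧ x = (s + ∑ i, w i, fun j => l j.succ - l 0)

theorem NF.of_single {d k : ℕ} {σ : Set (Fin d → ℝ)} {Qs : Fin (k + 1) → Set (Fin d → ℝ)}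
    (h0 : 0 ∈ σ) (i : Fin (k + 1)) {q : Fin d → ℝ} (hq : q ∈ Qs i) :
    NF σ Qs (q, fun j => (Pi.single i 1 : Fin (k + 1) → ℝ) j.succ -
      (Pi.single i 1 : Fin (k + 1) → ℝ) 0) := by
  refine ⟨0, h0, Pi.single i 1, Pi.single i q, fun i' => ?_, ?_⟩
  · by_cases h : i' = i
    · subst h
      rw [Pi.single_eq_same, Pi.single_eq_same]
      exact ⟨zero_le_one, by simp, fun _ => ⟨q, hq, by simp⟩⟩
    · simpa [Pi.single_eq_of_ne h] using InDil.zero (Qs i')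
  · simp

theorem tildeCone_NF {d k : ℕ} {σ : Set (Fin d → ℝ)} {Qs : Fin (k + 1) → Set (Fin d → ℝ)}
    (h0 : 0 ∈ σ) (hadd : ∀ x ∈ σ, ∀ y ∈ σ, x + y ∈ σ)
    (hsmul : ∀ t : ℝ, 0 ≤ t → ∀ x ∈ σ, t • x ∈ σ) (hQ : ∀ i, Convex ℝ (Qs i))
    {x : (Fin d → ℝ) × (Fin k → ℝ)} (hx : x ∈ tildeCone σ Qs) : NF σ Qs x := by
  obtain ⟨m, c, v, hc, hv, rfl⟩ := hx
  refine Finset.sum_induction _ (NF σ Qs) ?_ ?_ ?_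
  · rintro _ _ ⟨s, hs, l, w, hw, rfl⟩ ⟨s', hs', l', w', hw', rfl⟩
    refine ⟨s + s', hadd _ hs _ hs', l + l', w + w', fun i => (hw i).add (hQ i) (hw' i), ?_⟩
    ext j
    · simp [Finset.sum_add_distrib]; ring
    · simp; ring
  · exact ⟨0, h0, 0, 0, fun i => InDil.zero _, by ext <;> simp⟩
  · intro i _
    have key : NF σ Qs (v i) := by
      rcases hv i with (⟨n, hn, h⟩ | ⟨q, hq, h⟩) | h
      · rw [← h]
        exact ⟨n, hn, 0, 0, fun i => InDil.zero _, by ext <;> simp⟩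
      · rw [← h]
        convert NF.of_single h0 0 hq using 2
        ext j
        simp
      · obtain ⟨j, q, hq, h⟩ := Set.mem_iUnion.1 h
        rw [← h]
        convert NF.of_single h0 j.succ hq using 2
        ext j'
        simp [Pi.single_apply]
    obtain ⟨s, hs, l, w, hw, h⟩ := key
    refine ⟨c i • s, hsmul _ (hc i) _ hs, fun a => c i * l a, fun a => c i • w a,
      fun a => (hw a).smul (hc i), ?_⟩
    rw [h]
    ext j
    · simp [Finset.mul_sum]
    · simp; ring

theorem sum_inDil {d k : ℕ} {Qs : Fin (k + 1) → Set (Fin d → ℝ)} {l : ℝ} (hl : 0 < l)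
    {w : Fin (k + 1) → Fin d → ℝ} (hw : ∀ i, InDil (Qs i) l (w i)) :
    ∃ q ∈ ∑ i, Qs i, ∑ i, w i = l • q := by
  choose q hq h using fun i => (hw i).2.2 hl
  refine ⟨∑ i, q i, Set.finset_sum_mem_finset_sum _ _ _ fun i _ => hq i, ?_⟩
  rw [Finset.smul_sum]
  exact Finset.sum_congr rfl fun i _ => h i

/-- Lemma 2.7, first parts: `σ̃ ∩ (N_ℝ ⊕ {0}) = σ`, and if `0 ∉ Q`
then `σ̃` is strongly convex. -/
theorem tildeCone_inter_and_stronglyConvex {d k : ℕ}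
    (σ Q : Set (Fin d → ℝ)) (Qs : Fin (k + 1) → Set (Fin d → ℝ))
    (hσrat : IsRatPolyCone σ) (hσsc : IsStronglyConvex σ)
    (hQrat : IsRatPolyhedron Q) (hQσ : Q ⊆ σ)
    (hQsrat : ∀ i, IsRatPolyhedron (Qs i))
    (hdec : Q = ∑ i, Qs i)
    (hrec : ∀ i i', recCone (Qs i) = recCone (Qs i')) :
    {n : Fin d → ℝ | (n, (0 : Fin k → ℝ)) ∈ tildeCone σ Qs} = σ ∧
    ((0 : Fin d → ℝ) ∉ Q →
      tildeCone σ Qs ∩ -(tildeCone σ Qs) ⊆ {0}) := by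
  have h0 : (0 : Fin d → ℝ) ∈ σ := by
    obtain ⟨m, v, rfl⟩ := hσrat
    exact coneGen_zero _
  have hadd : ∀ x ∈ σ, ∀ y ∈ σ, x + y ∈ σ := by
    obtain ⟨m, v, rfl⟩ := hσrat
    exact fun x hx y hy => coneGen_add hx hy
  have hsmul : ∀ t : ℝ, 0 ≤ t → ∀ x ∈ σ, t • x ∈ σ := by
    obtain ⟨m, v, rfl⟩ := hσrat
    exact fun t ht x hx => coneGen_smul ht hx
  have hconv : ∀ i, Convex ℝ (Qs i) := fun i => (hQsrat i).convex'
  refine ⟨Set.Subset.antisymm ?_ ?_, ?_⟩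
  · intro n hn
    obtain ⟨s, hs, l, w, hw, h⟩ := tildeCone_NF h0 hadd hsmul hconv hn
    rw [Prod.mk.injEq] at h
    obtain ⟨rfl, h2⟩ := h
    have hl : ∀ i, l i = l 0 := by
      intro i
      refine Fin.cases rfl (fun j => ?_) i
      have := congrFun h2 j
      simp only [Pi.zero_apply] at this
      linarith
    refine hadd _ hs _ ?_
    rcases (hw 0).1.eq_or_lt with hz | hp
    · have : ∀ i, w i = 0 := fun i => (hw i).2.1 (by rw [hl i, ← hz])
      simpa [this] using h0
    · obtain ⟨q, hq, h⟩ := sum_inDil (Qs := Qs) hp (w := w) (fun i => hl i ▸ hw i)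
      rw [h]
      exact hsmul _ hp.le _ (hQσ (hdec ▸ hq))
  · intro n hn
    exact ⟨1, fun _ => 1, fun _ => (n, 0), fun _ => zero_le_one,
      fun _ => Or.inl (Or.inl ⟨n, hn, rfl⟩), by simp⟩
  · rintro h0Q x ⟨hx, hx'⟩
    obtain ⟨s, hs, l, w, hw, h⟩ := tildeCone_NF h0 hadd hsmul hconv hx
    obtain ⟨s', hs', l', w', hw', h'⟩ := tildeCone_NF h0 hadd hsmul hconv (Set.mem_neg.1 hx')
    have hsum : x + -x = 0 := add_neg_cancel x
    rw [h', h, Prod.mk_add_mk, Prod.mk_eq_zero] at hsum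
    obtain ⟨e1, e2⟩ := hsum
    have hl : ∀ i, l i + l' i = l 0 + l' 0 := by
      intro i
      refine Fin.cases rfl (fun j => ?_) i
      have := congrFun e2 j
      simp only [Pi.add_apply, Pi.zero_apply] at this
      linarith
    have hW : ∀ i, InDil (Qs i) (l 0 + l' 0) (w i + w' i) :=
      fun i => hl i ▸ (hw i).add (hconv i) (hw' i)
    rcases (hW 0).1.eq_or_lt with hz | hp
    · have hli : ∀ i, l i = 0 := fun i => by
        have := hl i
        have := (hw i).1
        have := (hw' i).1
        linarith
      have hli' : ∀ i, l' i = 0 := fun i => by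
        have := hl i
        have := hli i
        linarith
      have hwi : ∀ i, w i = 0 := fun i => (hw i).2.1 (hli i)
      have hwi' : ∀ i, w' i = 0 := fun i => (hw' i).2.1 (hli' i)
      simp only [hwi, hwi', Finset.sum_const_zero, add_zero] at e1
      have hs0 : s = 0 := hσsc ⟨hs, by
        rw [Set.mem_neg, neg_eq_of_add_eq_zero_right e1]
        exact hs'⟩
      rw [Set.mem_singleton_iff, h]
      ext j <;> simp [hwi, hli, hs0]
    · exfalso
      obtain ⟨q, hq, hqe⟩ := sum_inDil hp hW
      rw [← hdec] at hq
      rw [Finset.sum_add_distrib] at hqe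
      have e3 : (s + s') + (l 0 + l' 0) • q = 0 := by
        rw [← hqe, ← e1]
        abel
      have e4 : -q = (l 0 + l' 0)⁻¹ • (s + s') := by
        rw [eq_neg_of_add_eq_zero_left e3, smul_neg, inv_smul_smul₀ hp.ne']
      have hq0 : q = 0 := hσsc ⟨hQσ hq, by
        rw [Set.mem_neg, e4]
        exact hsmul _ (inv_nonneg.2 hp.le) _ (hadd _ hs _ hs')⟩
      exact h0Q (hq0 ▸ hq)
end
end

section
/- Let σ ⊆ N_ℝ be a full-dimensional strongly convex rational polyhedral cone with primitive edge generators a_1, …, a_N, and let S = {s_1, …, s_w} be a generating set of the semigroup σ^∨ ∩ M. Let u ∈ M and let Q ⊆ σ be a rational polyhedron with 0 ∉ Q, min⟨u,Q⟩ ≥ −1, and σ(u)^c ⊆ ℝ_{>0}·Q, where σ(u) = σ ∩ {n : ⟨u,n⟩ = −1} and σ(u)^c is the convex hull of the vertices of σ(u). Let Q = Q_0 + Q_1 + ⋯ + Q_k be a Minkowski sum decomposition into rational polyhedra satisfying condition (*). Fix l ∈ {1,…,N} with ⟨u, a_l⟩ < 0. Then for every (c_1,…,c_w) ∈ ℝ^w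 satisfying ∑_{j=1}^w c_j s_j = 0 and c_j = 0 whenever ⟨s_j, a_l⟩ ≥ ⟨−u, a_l⟩, one has ∑_{j=1}^w ⌊min⟨s_j, Q_i⟩⌋ c_j = 0 for every i ∈ {0,1,…,k}. -/
open Pointwise

noncomputable section

/-- A face of a cone: cut out by a supporting linear functional. -/
def IsFaceOfCone {d : ℕ} (σ F : Set (Fin d → ℝ)) : Prop :=
  ∃ u : Fin d → ℝ, u ∈ dualCone σ ∧ F = {n ∈ σ | pr u n = 0}

theorem pr_add_right {d : ℕ} (u x y : Fin d → ℝ) : pr u (x + y) = pr u x + pr u y := by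
  simp [pr, mul_add, Finset.sum_add_distrib]

theorem pr_smul_right {d : ℕ} (u : Fin d → ℝ) (t : ℝ) (x : Fin d → ℝ) :
    pr u (t • x) = t * pr u x := by
  simp only [pr, Finset.mul_sum, Pi.smul_apply, smul_eq_mul]
  exact Finset.sum_congr rfl fun j _ => by ring

theorem pr_sum_right {d : ℕ} {ι : Type*} (A : Finset ι) (u : Fin d → ℝ) (x : ι → Fin d → ℝ) :
    pr u (∑ i ∈ A, x i) = ∑ i ∈ A, pr u (x i) := by
  simp only [pr, Finset.sum_apply, Finset.mul_sum]
  exact Finset.sum_comm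

theorem pr_comm' {d : ℕ} (u x : Fin d → ℝ) : pr u x = pr x u := by
  simp only [pr]
  exact Finset.sum_congr rfl fun j _ => by ring

theorem pr_cont {d : ℕ} (u : Fin d → ℝ) : Continuous (pr u) := by
  unfold pr
  fun_prop

theorem coneGen_singleton_sub {d : ℕ} {a x : Fin d → ℝ} (h : x ∈ coneGen {a}) :
    ∃ c : ℝ, 0 ≤ c ∧ x = c • a := by
  obtain ⟨m, c, v, hc, hv, rfl⟩ := h
  refine ⟨∑ i, c i, Finset.sum_nonneg fun i _ => hc i, ?_⟩
  rw [Finset.sum_smul]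
  exact Finset.sum_congr rfl fun i _ => by rw [hv i]

theorem coneGen_self_mem {d : ℕ} {S : Set (Fin d → ℝ)} {a : Fin d → ℝ} (h : a ∈ S) {t : ℝ}
    (ht : 0 ≤ t) : t • a ∈ coneGen S :=
  ⟨1, fun _ => t, fun _ => a, fun _ => ht, fun _ => h, by simp⟩

theorem coneGen_range {d N : ℕ} {a : Fin N → Fin d → ℝ} {x : Fin d → ℝ}
    (h : x ∈ coneGen (Set.range a)) : ∃ c : Fin N → ℝ, (∀ i, 0 ≤ c i) ∧ x = ∑ i, c i • a i := by
  obtain ⟨m, c, v, hc, hv, rfl⟩ := h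
  choose f hf using hv
  refine ⟨fun i => ∑ j ∈ Finset.univ.filter (fun j => f j = i), c j,
    fun i => Finset.sum_nonneg fun j _ => hc j, ?_⟩
  rw [← Finset.sum_fiberwise Finset.univ f]
  refine Finset.sum_congr rfl fun i _ => ?_
  rw [Finset.sum_smul]
  refine Finset.sum_congr rfl fun j hj => ?_
  rw [← hf j, (Finset.mem_filter.1 hj).2]

/-- A strongly convex cone with nonzero generators has a functional controlling the norm. -/
theorem exists_pos_functional {d N : ℕ} (a : Fin N → Fin d → ℝ) (hne : ∀ l, a l ≠ 0)
    (hsc : IsStronglyConvex (coneGen (Set.range a))) :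
    ∃ (v : Fin d → ℝ) (C : ℝ), 0 ≤ C ∧ ∀ x ∈ coneGen (Set.range a), ‖x‖ ≤ C * pr v x := by
  have h0 : (0 : Fin d → ℝ) ∉ convexHull ℝ (Set.range a) := by
    intro h
    obtain ⟨c, hc, hc1, hc2⟩ : ∃ c : Fin N → ℝ, (∀ i, 0 ≤ c i) ∧ ∑ i, c i = 1 ∧
        ∑ i, c i • a i = 0 := by
      rw [convexHull_eq] at h
      obtain ⟨ι, T, w, z, hw, hw1, hz, hx⟩ := h
      have hz' : ∀ i, ∃ l, i ∈ T → a l = z i := by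
        intro i
        by_cases hi : i ∈ T
        · obtain ⟨l, hl⟩ := hz i hi
          exact ⟨l, fun _ => hl⟩
        · obtain ⟨i', hi'⟩ : T.Nonempty := by
            rw [Finset.nonempty_iff_ne_empty]
            rintro rfl
            simp at hw1
          obtain ⟨l, -⟩ := hz i' hi'
          exact ⟨l, fun h => absurd h hi⟩
      choose f hf using hz'
      refine ⟨fun l => ∑ i ∈ T.filter (fun i => f i = l), w i,
        fun l => Finset.sum_nonneg fun i hi => hw i (Finset.mem_filter.1 hi).1, ?_, ?_⟩
      · rw [← hw1]
        exact Finset.sum_fiberwise T f w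
      · rw [Finset.centerMass_eq_of_sum_1 _ _ hw1] at hx
        rw [← hx, ← Finset.sum_fiberwise T f]
        refine Finset.sum_congr rfl fun l _ => ?_
        rw [Finset.sum_smul]
        refine Finset.sum_congr rfl fun i hi => ?_
        obtain ⟨h1, h2⟩ := Finset.mem_filter.1 hi
        rw [← hf i h1, h2]
    obtain ⟨l, hl⟩ : ∃ l, 0 < c l := by
      by_contra hcon
      push Not at hcon
      have : ∑ i, c i ≤ 0 := Finset.sum_nonpos fun i _ => hcon i
      linarith
    have h1 : c l • a l ∈ coneGen (Set.range a) := coneGen_self_mem (Set.mem_range_self l) hl.le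
    have h2 : -(c l • a l) ∈ coneGen (Set.range a) := by
      refine ⟨N, Function.update c l 0, a, fun i => ?_, fun i => ⟨i, rfl⟩, ?_⟩
      · by_cases hi : i = l
        · subst hi; simp
        · simpa [hi] using hc i
      · rw [← Finset.add_sum_erase _ _ (Finset.mem_univ l)] at hc2 ⊢
        rw [neg_eq_of_add_eq_zero_right hc2]
        simp only [Function.update_self, zero_smul, zero_add]
        refine Finset.sum_congr rfl fun i hi => ?_
        rw [Function.update_of_ne (Finset.ne_of_mem_erase hi)]
    have h3 : c l • a l = 0 := hsc ⟨h1, h2⟩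
    rcases smul_eq_zero.1 h3 with h | h
    · exact hl.ne' h
    · exact hne l h
  obtain ⟨f, r, hr, hf⟩ := geometric_hahn_banach_point_closed (convex_convexHull ℝ (Set.range a))
    ((Set.finite_range a).isCompact_convexHull ℝ).isClosed h0
  have hr0 : 0 < r := by simpa using hr
  let v : Fin d → ℝ := fun j => f (Pi.single j 1)
  have hv : ∀ x, f x = pr v x := by
    intro x
    conv_lhs => rw [pi_eq_sum_univ' x]
    simp [pr, v, map_sum, mul_comm]
  have hfa : ∀ l, r < pr v (a l) := fun l => by
    rw [← hv]; exact hf _ (subset_convexHull ℝ _ ⟨l, rfl⟩)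
  let K : ℝ := ∑ l, ‖a l‖
  have hK : 0 ≤ K := Finset.sum_nonneg fun l _ => norm_nonneg _
  refine ⟨v, K / r, by positivity, fun x hx => ?_⟩
  obtain ⟨c, hc, rfl⟩ := coneGen_range hx
  have h1 : ‖∑ i, c i • a i‖ ≤ (∑ i, c i) * K := by
    refine (norm_sum_le _ _).trans ?_
    rw [Finset.sum_mul]
    refine Finset.sum_le_sum fun i _ => ?_
    rw [norm_smul, Real.norm_of_nonneg (hc i)]
    exact mul_le_mul_of_nonneg_left
      (Finset.single_le_sum (f := fun l => ‖a l‖) (fun l _ => norm_nonneg _) (Finset.mem_univ i))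
      (hc i)
  have h2 : (∑ i, c i) * r ≤ pr v (∑ i, c i • a i) := by
    rw [pr_sum_right, Finset.sum_mul]
    refine Finset.sum_le_sum fun i _ => ?_
    rw [pr_smul_right]
    exact mul_le_mul_of_nonneg_left (hfa i).le (hc i)
  calc _ ≤ (∑ i, c i) * K := h1
    _ = K / r * ((∑ i, c i) * r) := by field_simp
    _ ≤ _ := mul_le_mul_of_nonneg_left h2 (by positivity)

theorem convex_eq_min {α β x y m : ℝ} (hα : 0 < α) (hβ : 0 < β) (h : α + β = 1)
    (hx : m ≤ x) (hy : m ≤ y) (e : α * x + β * y = m) : x = m ∧ y = m := by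
  have h1 : 0 ≤ α * (x - m) := mul_nonneg hα.le (by linarith)
  have h2 : 0 ≤ β * (y - m) := mul_nonneg hβ.le (by linarith)
  have h3 : α * (x - m) + β * (y - m) = 0 := by linear_combination e - m * h
  have h4 : α * (x - m) = 0 := by linarith
  have h5 : β * (y - m) = 0 := by linarith
  constructor
  · rcases mul_eq_zero.1 h4 with h | h <;> linarith
  · rcases mul_eq_zero.1 h5 with h | h <;> linarith

theorem exists_extreme_min {d : ℕ} {Q : Set (Fin d → ℝ)} (hcl : IsClosed Q) (v : Fin d → ℝ)
    (C : ℝ) (hC0 : 0 ≤ C) (hC : ∀ x ∈ Q, ‖x‖ ≤ C * pr v x) (g q₀ : Fin d → ℝ) (hq₀ : q₀ ∈ Q)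
    (hmin : ∀ q ∈ Q, pr g q₀ ≤ pr g q) :
    ∃ p ∈ Q.extremePoints ℝ, pr g p = pr g q₀ := by
  have hgc := pr_cont g
  have hvc := pr_cont v
  have hFcl : IsClosed {x | x ∈ Q ∧ pr g x = pr g q₀} :=
    hcl.inter (isClosed_eq hgc continuous_const)
  have hKc : IsCompact {x | (x ∈ Q ∧ pr g x = pr g q₀) ∧ pr v x ≤ pr v q₀} := by
    refine Metric.isCompact_of_isClosed_isBounded
      (hFcl.inter (isClosed_le hvc continuous_const)) ?_
    refine (Metric.isBounded_closedBall (x := (0 : Fin d → ℝ)) (r := |C| * |pr v q₀|)).subset ?_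
    rintro x ⟨⟨hx, -⟩, hxv⟩
    rw [mem_closedBall_zero_iff]
    have h1 := hC x hx
    rw [abs_of_nonneg hC0]
    exact h1.trans (mul_le_mul_of_nonneg_left (hxv.trans (le_abs_self _)) hC0)
  obtain ⟨x₀, ⟨⟨hx₀Q, hx₀g⟩, hx₀v⟩, hx₀min⟩ :=
    hKc.exists_isMinOn ⟨q₀, ⟨hq₀, rfl⟩, le_rfl⟩ hvc.continuousOn
  have hGc : IsCompact {x | (x ∈ Q ∧ pr g x = pr g q₀) ∧ pr v x = pr v x₀} := by
    refine hKc.of_isClosed_subset (hFcl.inter (isClosed_eq hvc continuous_const)) ?_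
    rintro x ⟨hx, hxv⟩
    exact ⟨hx, hxv.le.trans hx₀v⟩
  obtain ⟨p, hp⟩ := hGc.extremePoints_nonempty ⟨x₀, ⟨hx₀Q, hx₀g⟩, rfl⟩
  rw [mem_extremePoints] at hp
  obtain ⟨⟨⟨hpQ, hpg⟩, hpv⟩, hpe⟩ := hp
  refine ⟨p, ?_, hpg⟩
  rw [mem_extremePoints]
  refine ⟨hpQ, fun x hx y hy hxy => ?_⟩
  have hxy' := hxy
  obtain ⟨α, β, hα, hβ, hab, rfl⟩ := hxy
  rw [pr_add_right, pr_smul_right, pr_smul_right] at hpg hpv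
  obtain ⟨hxg, hyg⟩ := convex_eq_min hα hβ hab (hmin x hx) (hmin y hy) hpg
  have key : ∀ z ∈ Q, pr g z = pr g q₀ → pr v x₀ ≤ pr v z := by
    intro z hz hzg
    rcases le_total (pr v z) (pr v q₀) with h | h
    · exact hx₀min (show _ ∈ _ from ⟨⟨hz, hzg⟩, h⟩)
    · exact hx₀v.trans h
  obtain ⟨hxv, hyv⟩ := convex_eq_min hα hβ hab (key x hx hxg) (key y hy hyg) hpv
  exact hpe x ⟨⟨hx, hxg⟩, hxv⟩ y ⟨⟨hy, hyg⟩, hyv⟩ hxy'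

theorem extreme_summand {d k : ℕ} (Qs : Fin (k + 1) → Set (Fin d → ℝ))
    (ps : Fin (k + 1) → Fin d → ℝ) (hps : ∀ i, ps i ∈ Qs i)
    (hp : ∑ i, ps i ∈ (∑ i, Qs i).extremePoints ℝ) (i : Fin (k + 1)) :
    ps i ∈ (Qs i).extremePoints ℝ := by
  rw [mem_extremePoints] at hp ⊢
  refine ⟨hps i, fun x hx y hy hxy => ?_⟩
  obtain ⟨α, β, hα, hβ, hab, he⟩ := hxy
  have hmem : ∀ z ∈ Qs i, (∑ j, ps j) + (z - ps i) ∈ ∑ j, Qs j := by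
    intro z hz
    have : (∑ j, ps j) + (z - ps i) = ∑ j, Function.update ps i z j := by
      rw [Finset.sum_update_of_mem (Finset.mem_univ i),
        ← Finset.add_sum_erase _ _ (Finset.mem_univ i), Finset.sdiff_singleton_eq_erase]
      abel
    rw [this]
    refine Set.finsetSum_mem_finsetSum _ _ _ fun j _ => ?_
    by_cases hj : j = i
    · subst hj; simpa using hz
    · simpa [hj] using hps j
  have h := hp.2 _ (hmem x hx) _ (hmem y hy) ⟨α, β, hα, hβ, hab, by
    rw [← he]
    have : β = 1 - α := by linarith
    subst this
    module⟩
  have h1 := h.1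
  have h2 := h.2
  rw [add_eq_left, sub_eq_zero] at h1 h2
  exact ⟨h1, h2⟩

theorem floor_sum_eq {k : ℕ} (z : Fin (k + 1) → ℝ) (i₀ : Fin (k + 1))
    (h : ∀ i, i ≠ i₀ → ∃ n : ℤ, z i = n) : ⌊∑ i, z i⌋ = ∑ i, ⌊z i⌋ := by
  have h1 : ∑ i ∈ Finset.univ.erase i₀, z i
      = ((∑ i ∈ Finset.univ.erase i₀, ⌊z i⌋ : ℤ) : ℝ) := by
    rw [Int.cast_sum]
    refine Finset.sum_congr rfl fun i hi => ?_
    obtain ⟨n, hn⟩ := h i (Finset.ne_of_mem_erase hi)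
    rw [hn, Int.floor_intCast]
  rw [← Finset.add_sum_erase _ _ (Finset.mem_univ i₀), h1, Int.floor_add_intCast,
    ← Finset.add_sum_erase _ (fun i => ⌊z i⌋) (Finset.mem_univ i₀)]

theorem pr_lattice {d : ℕ} (s : Fin d → ℤ) (x : Fin d → ℝ) (h : IsLattice x) :
    ∃ n : ℤ, pr (castd s) x = n := by
  choose z hz using h
  refine ⟨∑ j, s j * z j, ?_⟩
  simp [pr, castd, hz]

/-- from the proof of Theorem 2.14: the linear map
`(c₁,…,c_w) ↦ ∑_j ⌊min⟨s_j,Q_i⟩⌋ c_j` vanishes on the relations supported on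
`S_l^{-u} = {s ∈ S : ⟨s, a_l⟩ < ⟨−u, a_l⟩}`. -/
theorem kodaira_spencer_vanishing {d k N w : ℕ}
    (σ : Set (Fin d → ℝ)) (a : Fin N → Fin d → ℤ)
    (hσ : σ = coneGen (Set.range fun l => castd (a l)))
    (hσsc : IsStronglyConvex σ)
    (hfull : (interior σ).Nonempty)
    (hedge : ∀ l, IsFaceOfCone σ (coneGen {castd (a l)}))
    (hprim : ∀ l, ∀ t : ℝ, 0 < t → t < 1 → ¬ IsLattice (t • castd (a l)))
    (s : Fin w → Fin d → ℤ)
    (hsdual : ∀ j, castd (s j) ∈ dualCone σ)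
    (hsgen : ∀ u : Fin d → ℤ, castd u ∈ dualCone σ →
      ∃ c : Fin w → ℕ, u = ∑ j, (c j : ℤ) • s j)
    (u : Fin d → ℤ)
    (Q : Set (Fin d → ℝ)) (Qs : Fin (k + 1) → Set (Fin d → ℝ))
    (hQrat : IsRatPolyhedron Q) (hQσ : Q ⊆ σ) (hQ0 : (0 : Fin d → ℝ) ∉ Q)
    (hmin : ∀ q ∈ Q, -1 ≤ pr (castd u) q)
    (hσu : convexHull ℝ ((σ ∩ {n | pr (castd u) n = -1}).extremePoints ℝ) ⊆
      {x | ∃ t : ℝ, 0 < t ∧ ∃ q ∈ Q, x = t • q})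
    (hQsrat : ∀ i, IsRatPolyhedron (Qs i))
    (hdec : Q = ∑ i, Qs i)
    (hrec : ∀ i i', recCone (Qs i) = recCone (Qs i'))
    (hstar : CondStar Q Qs)
    (l : Fin N) (hl : pr (castd u) (castd (a l)) < 0)
    -- `μ j i = min⟨s_j, Q_i⟩`, the (attained) minimum of `s_j` on `Q_i`
    (μ : Fin w → Fin (k + 1) → ℝ)
    (hμ : ∀ j i, μ j i ∈ (pr (castd (s j))) '' Qs i ∧
      ∀ q ∈ Qs i, μ j i ≤ pr (castd (s j)) q) :
    ∀ c : Fin w → ℝ, (∑ j, c j • castd (s j)) = 0 →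
      (∀ j, -pr (castd u) (castd (a l)) ≤ pr (castd (s j)) (castd (a l)) → c j = 0) →
      ∀ i, ∑ j, (⌊μ j i⌋ : ℝ) * c j = 0 := by
  intro c hc hc0
  have hpr0 : ∀ x : Fin d → ℝ, ∑ j, c j * pr (castd (s j)) x = 0 := by
    intro x
    have : pr x (∑ j, c j • castd (s j)) = 0 := by rw [hc]; simp [pr]
    rw [pr_sum_right] at this
    rw [← this]
    exact Finset.sum_congr rfl fun j _ => by rw [pr_smul_right, pr_comm']
  have hane : ∀ l, castd (a l) ≠ 0 := by
    intro l h
    refine hprim l (1 / 2) (by norm_num) (by norm_num) ?_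
    rw [h, smul_zero]
    exact fun j => ⟨0, by simp⟩
  obtain ⟨v, C, hC0, hvC⟩ := exists_pos_functional (fun l => castd (a l)) hane (hσ ▸ hσsc)
  rw [← hσ] at hvC
  have hQcl : IsClosed Q := by
    obtain ⟨m, A, b, rfl⟩ := hQrat
    simp only [Set.ofPred_forall]
    exact isClosed_iInter fun i => isClosed_le continuous_const (by fun_prop)
  -- vertices of `Q` minimising a functional
  have hvert : ∀ g q₀ : Fin d → ℝ, q₀ ∈ Q → (∀ q ∈ Q, pr g q₀ ≤ pr g q) →
      ∃ ps : Fin (k + 1) → Fin d → ℝ, (∀ i, ps i ∈ Qs i) ∧ (∑ i, ps i) ∈ Q ∧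
        pr g (∑ i, ps i) = pr g q₀ ∧ ∃ i₀, ∀ i, i ≠ i₀ → IsLattice (ps i) := by
    intro g q₀ hq₀ hm
    obtain ⟨p, hp, hpg⟩ := exists_extreme_min hQcl v C hC0 (fun x hx => hvC x (hQσ hx)) g q₀ hq₀ hm
    have hpQ : p ∈ Q := hp.1
    have hpQ' := hpQ
    rw [hdec, Set.mem_fintype_sum] at hpQ'
    obtain ⟨ps, hps, rfl⟩ := hpQ'
    refine ⟨ps, hps, hpQ, hpg, ?_⟩
    exact hstar _ hp ps (extreme_summand Qs ps hps (hdec ▸ hp)) rfl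
  -- the ray through `a l` meets `Q`
  obtain ⟨ul, hul, hface⟩ := hedge l
  have hray : ∀ x ∈ σ, pr ul x = 0 → ∃ t : ℝ, 0 ≤ t ∧ x = t • castd (a l) := by
    intro x hx h
    refine coneGen_singleton_sub ?_
    rw [hface]
    exact ⟨hx, h⟩
  have hal : castd (a l) ∈ σ ∧ pr ul (castd (a l)) = 0 := by
    have : castd (a l) ∈ coneGen {castd (a l)} := by
      simpa using coneGen_self_mem (S := {castd (a l)}) rfl (zero_le_one)
    rw [hface] at this
    exact this
  set b : ℝ := pr (castd u) (castd (a l)) with hb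
  have hext : (-b)⁻¹ • castd (a l) ∈ (σ ∩ {n | pr (castd u) n = -1}).extremePoints ℝ := by
    have hnb : 0 < -b := by linarith
    rw [mem_extremePoints]
    refine ⟨⟨?_, ?_⟩, ?_⟩
    · rw [hσ]
      exact coneGen_self_mem (Set.mem_range_self l) (by positivity)
    · show pr _ _ = _
      rw [pr_smul_right, ← hb, inv_neg, neg_mul, inv_mul_cancel₀ hl.ne]
    · rintro x ⟨hx, hxu⟩ y ⟨hy, hyu⟩ ⟨α, β, hα, hβ, hab, he⟩
      have h1 : α * pr ul x + β * pr ul y = 0 := by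
        have := congrArg (pr ul) he
        rwa [pr_add_right, pr_smul_right, pr_smul_right, pr_smul_right, hal.2, mul_zero] at this
      obtain ⟨hx0, hy0⟩ := convex_eq_min hα hβ hab (hul x hx) (hul y hy) h1
      have key : ∀ z ∈ σ, pr (castd u) z = -1 → pr ul z = 0 → z = (-b)⁻¹ • castd (a l) := by
        intro z hz hzu hz0
        obtain ⟨t, -, rfl⟩ := hray z hz hz0
        rw [pr_smul_right, ← hb] at hzu
        congr 1
        refine eq_inv_of_mul_eq_one_left ?_
        linarith
      exact ⟨key x hx hxu hx0, key y hy hyu hy0⟩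
  obtain ⟨t, ht, q₀, hq₀, hq₀e⟩ := hσu (subset_convexHull ℝ _ hext)
  have hq₀u : pr ul q₀ = 0 := by
    have := congrArg (pr ul) hq₀e
    rw [pr_smul_right, pr_smul_right, hal.2, mul_zero] at this
    rcases mul_eq_zero.1 this.symm with h | h
    · exact absurd h ht.ne'
    · exact h
  obtain ⟨qs, hqs, hqQ, hqu, i₀, hi₀⟩ := hvert ul q₀ hq₀ (fun q hq => by
    rw [hq₀u]; exact hul q (hQσ hq))
  rw [hq₀u] at hqu
  obtain ⟨t₀, ht₀, hq⟩ := hray _ (hQσ hqQ) hqu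
  have ht₀b : -1 ≤ t₀ * b := by
    have := hmin _ hqQ
    rwa [hq, pr_smul_right] at this
  -- comparison of floors
  have hfl : ∀ j, c j ≠ 0 → (∀ i, ⌊μ j i⌋ = ⌊pr (castd (s j)) (qs i)⌋) ∧ ∑ i, ⌊μ j i⌋ = 0 := by
    intro j hj
    have hlt : pr (castd (s j)) (castd (a l)) < -b := by
      by_contra h
      exact hj (hc0 j (not_lt.1 h))
    have hq1 : pr (castd (s j)) (∑ i, qs i) < 1 := by
      rw [hq, pr_smul_right]
      rcases ht₀.eq_or_lt with h | h
      · rw [← h]; norm_num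
      · nlinarith [mul_lt_mul_of_pos_left hlt h]
    have hq0 : 0 ≤ pr (castd (s j)) (∑ i, qs i) := hsdual j _ (hQσ hqQ)
    choose xs hxs hxμ using fun i => (hμ j i).1
    have hxQ : ∑ i, xs i ∈ Q := by
      rw [hdec]
      exact Set.finsetSum_mem_finsetSum _ _ _ fun i _ => hxs i
    have hxsum : pr (castd (s j)) (∑ i, xs i) = ∑ i, μ j i := by
      rw [pr_sum_right]; exact Finset.sum_congr rfl fun i _ => hxμ i
    have hle : ∀ ys : Fin (k + 1) → Fin d → ℝ, (∀ i, ys i ∈ Qs i) →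
        ∑ i, μ j i ≤ pr (castd (s j)) (∑ i, ys i) := by
      intro ys hys
      rw [pr_sum_right]
      exact Finset.sum_le_sum fun i _ => (hμ j i).2 _ (hys i)
    obtain ⟨ps, hps, hpQ, hpe, i₁, hi₁⟩ := hvert (castd (s j)) _ hxQ (by
      intro q hq
      rw [hdec, Set.mem_fintype_sum] at hq
      obtain ⟨ys, hys, rfl⟩ := hq
      rw [hxsum]
      exact hle ys hys)
    have hpμ : ∀ i, μ j i = pr (castd (s j)) (ps i) := by
      rw [hxsum, pr_sum_right] at hpe
      intro i
      exact (Finset.sum_eq_sum_iff_of_le fun i _ => (hμ j i).2 _ (hps i)).1 hpe.symm i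
        (Finset.mem_univ i)
    have hμ0 : 0 ≤ ∑ i, μ j i := by
      rw [← hxsum]; exact hsdual j _ (hQσ hxQ)
    have hμ1 : ∑ i, μ j i < 1 := (hle qs hqs).trans_lt hq1
    have e1 : ∑ i, ⌊μ j i⌋ = 0 := by
      rw [← floor_sum_eq _ i₁ (fun i hi => by
        rw [hpμ i]; exact pr_lattice _ _ (hi₁ i hi)), Int.floor_eq_zero_iff]
      exact ⟨hμ0, hμ1⟩
    have e2 : ∑ i, ⌊pr (castd (s j)) (qs i)⌋ = 0 := by
      rw [← floor_sum_eq _ i₀ (fun i hi => pr_lattice _ _ (hi₀ i hi)), ← pr_sum_right,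
        Int.floor_eq_zero_iff]
      exact ⟨hq0, hq1⟩
    refine ⟨fun i => ?_, e1⟩
    exact (Finset.sum_eq_sum_iff_of_le fun i _ => Int.floor_le_floor ((hμ j i).2 _ (hqs i))).1
      (e1.trans e2.symm) i (Finset.mem_univ i)
  have hoff : ∀ i, i ≠ i₀ → ∑ j, (⌊μ j i⌋ : ℝ) * c j = 0 := by
    intro i hi
    rw [← hpr0 (qs i)]
    refine Finset.sum_congr rfl fun j _ => ?_
    by_cases hj : c j = 0
    · simp [hj]
    · rw [(hfl j hj).1 i]
      obtain ⟨n, hn⟩ := pr_lattice (s j) _ (hi₀ i hi)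
      rw [hn, Int.floor_intCast, mul_comm]
  have htot : ∑ i, ∑ j, (⌊μ j i⌋ : ℝ) * c j = 0 := by
    rw [Finset.sum_comm]
    refine Finset.sum_eq_zero fun j _ => ?_
    rw [← Finset.sum_mul]
    by_cases hj : c j = 0
    · simp [hj]
    · have := (hfl j hj).2
      rw [← Int.cast_sum, this]; simp
  intro i
  by_cases hi : i = i₀
  · subst hi
    rw [← Finset.add_sum_erase _ _ (Finset.mem_univ i),
      Finset.sum_eq_zero (fun x hx => hoff x (Finset.ne_of_mem_erase hx)), add_zero] at htot
    exact htot
  · exact hoff i hi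
end
end
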